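/- arXiv:1811.07609 — 2 statements merged into one kernel-verified Lean document; each statement's English description precedes it below -/
import Mathlib

section
/- Fix a real N×N matrix A, matrices G ∈ ℝ^{N×K}, H ∈ ℝ^{K×N}, U ∈ ℝ^{N×K}, W ∈ ℝ^{K×K}, a constant β > 0, outlier scores O_{1i}, O_{3i} ∈ (0,1], and indices i, k. Consider the function of a single real variable t given by φ(t) = log(1/O_{1i}) · ∑_j (A_{ij} − ∑_{k'≠k} G_{ik'}H_{k'j} − t·H_{kj})² + β·log(1/O_{3i}) · (t − ∑_{k'} U_{ik'}W_{kk'})². If the denominator D = log(1/O_{1i})·∑_j H_{kj}² + β·log(1/O_{3i}) is strictly positive, then φ attains its unique minimum at t* = [log(1/O_{1i}) · ∑_j (A_{ij} − ∑_{k'≠k} G_{ik'}H_{k'j})·H_{kj} + β·log(1/O_{3i}) · ∑_{k'} W_{kk'}U_{ik'}] / D, which is the update rule for G_{ik} (Eq. 6) of the paper. -/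
/-- The coordinate update rule for `G_{ik}` (Eq. 6 of the paper): the single-variable
function obtained from the joint loss attains its unique minimum at the stated `t*`. -/
theorem stmt_12 (N K : ℕ) (A : Matrix (Fin N) (Fin N) ℝ)
    (G : Matrix (Fin N) (Fin K) ℝ) (H : Matrix (Fin K) (Fin N) ℝ)
    (U : Matrix (Fin N) (Fin K) ℝ) (W : Matrix (Fin K) (Fin K) ℝ)
    (β : ℝ) (hβ : β > 0)
    (O₁ O₃ : Fin N → ℝ) (hO₁ : ∀ i', 0 < O₁ i' ∧ O₁ i' ≤ 1)
    (hO₃ : ∀ i', 0 < O₃ i' ∧ O₃ i' ≤ 1)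
    (i : Fin N) (k : Fin K)
    (φ : ℝ → ℝ)
    (hφ : ∀ t, φ t =
      Real.log (1 / O₁ i) *
          ∑ j, (A i j - (∑ k' ∈ Finset.univ.erase k, G i k' * H k' j) - t * H k j) ^ 2
        + β * Real.log (1 / O₃ i) * (t - ∑ k', U i k' * W k k') ^ 2)
    (D : ℝ)
    (hD : D = Real.log (1 / O₁ i) * (∑ j, (H k j) ^ 2) + β * Real.log (1 / O₃ i))
    (hDpos : 0 < D)
    (tstar : ℝ)
    (htstar : tstar =
      (Real.log (1 / O₁ i) *
          ∑ j, (A i j - ∑ k' ∈ Finset.univ.erase k, G i k' * H k' j) * H k j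
        + β * Real.log (1 / O₃ i) * ∑ k', W k k' * U i k') / D) :
    ∀ t : ℝ, t ≠ tstar → φ tstar < φ t := by
  intro t ht
  have hsum : ∀ s : ℝ,
      ∑ j, (A i j - (∑ k' ∈ Finset.univ.erase k, G i k' * H k' j) - s * H k j) ^ 2
      = ∑ j, (A i j - ∑ k' ∈ Finset.univ.erase k, G i k' * H k' j) ^ 2
        - 2 * s * ∑ j, (A i j - ∑ k' ∈ Finset.univ.erase k, G i k' * H k' j) * H k j
        + s ^ 2 * ∑ j, (H k j) ^ 2 := by
    intro s
    rw [Finset.mul_sum, Finset.mul_sum, ← Finset.sum_sub_distrib, ← Finset.sum_add_distrib]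
    refine Finset.sum_congr rfl fun j _ => ?_
    ring
  have hc : ∑ k', U i k' * W k k' = ∑ k', W k k' * U i k' :=
    Finset.sum_congr rfl fun _ _ => mul_comm _ _
  rw [eq_div_iff hDpos.ne'] at htstar
  have hpos : 0 < D * (t - tstar) ^ 2 :=
    mul_pos hDpos (pow_pos (abs_pos.mpr (sub_ne_zero.mpr ht)) 2 |>.trans_eq (sq_abs _))
  have key : φ t - φ tstar = D * (t - tstar) ^ 2 := by
    rw [hφ t, hφ tstar, hsum, hsum, hc]
    linear_combination (2 * (t - tstar)) * htstar - (t ^ 2 - tstar ^ 2) * hD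
  linarith
end

section
/- Fix a real N×D matrix C, matrices G ∈ ℝ^{N×K}, U ∈ ℝ^{N×K}, V ∈ ℝ^{K×D}, W ∈ ℝ^{K×K}, constants α, β > 0, outlier scores O_{2i}, O_{3i} ∈ (0,1], and indices i, k. Consider the function of a single real variable t given by φ(t) = α·log(1/O_{2i}) · ∑_d (C_{id} − ∑_{k'≠k} U_{ik'}V_{k'd} − t·V_{kd})² + β·log(1/O_{3i}) · ∑_m (G_{im} − ∑_{k'≠k} U_{ik'}W_{mk'} − t·W_{mk})². If the denominator D = α·log(1/O_{2i})·∑_d V_{kd}² + β·log(1/O_{3i})·∑_m W_{mk}² is strictly positive, then φ attains its unique minimum at t* = [α·log(1/O_{2i}) · ∑_d (C_{id} − ∑_{k'≠k} U_{ik'}V_{k'd})·V_{kd} + β·log(1/O_{3i}) · ∑_m (G_{im} − ∑_{k'≠k} U_{ik'}W_{mk'})·W_{mk}] / D, which is the update rule for U_{ik} (Eq. 8) of the paper. -/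
theorem expand_sq_sum {n : ℕ} (a v : Fin n → ℝ) (t : ℝ) :
    ∑ d, (a d - t * v d) ^ 2
      = ∑ d, (a d) ^ 2 - 2 * t * ∑ d, a d * v d + t ^ 2 * ∑ d, (v d) ^ 2 := by
  rw [Finset.mul_sum, Finset.mul_sum, ← Finset.sum_sub_distrib, ← Finset.sum_add_distrib]
  exact Finset.sum_congr rfl fun d _ => by ring

/-- The coordinate update rule for `U_{ik}` (Eq. 8 of the paper): the single-variable
function obtained from the joint loss attains its unique minimum at the stated `t*`. -/
theorem stmt_14 (N D' K : ℕ) (C : Matrix (Fin N) (Fin D') ℝ)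
    (G : Matrix (Fin N) (Fin K) ℝ) (U : Matrix (Fin N) (Fin K) ℝ)
    (V : Matrix (Fin K) (Fin D') ℝ) (W : Matrix (Fin K) (Fin K) ℝ)
    (α β : ℝ) (hα : α > 0) (hβ : β > 0)
    (O₂ O₃ : Fin N → ℝ) (hO₂ : ∀ i', 0 < O₂ i' ∧ O₂ i' ≤ 1)
    (hO₃ : ∀ i', 0 < O₃ i' ∧ O₃ i' ≤ 1)
    (i : Fin N) (k : Fin K)
    (φ : ℝ → ℝ)
    (hφ : ∀ t, φ t =
      α * Real.log (1 / O₂ i) *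
          ∑ d, (C i d - (∑ k' ∈ Finset.univ.erase k, U i k' * V k' d) - t * V k d) ^ 2
        + β * Real.log (1 / O₃ i) *
          ∑ m, (G i m - (∑ k' ∈ Finset.univ.erase k, U i k' * W m k') - t * W m k) ^ 2)
    (D : ℝ)
    (hD : D = α * Real.log (1 / O₂ i) * (∑ d, (V k d) ^ 2)
        + β * Real.log (1 / O₃ i) * (∑ m, (W m k) ^ 2))
    (hDpos : 0 < D)
    (tstar : ℝ)
    (htstar : tstar =
      (α * Real.log (1 / O₂ i) *
          ∑ d, (C i d - ∑ k' ∈ Finset.univ.erase k, U i k' * V k' d) * V k d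
        + β * Real.log (1 / O₃ i) *
          ∑ m, (G i m - ∑ k' ∈ Finset.univ.erase k, U i k' * W m k') * W m k) / D) :
    ∀ t : ℝ, t ≠ tstar → φ tstar < φ t := by
  intro t ht
  have h1 := expand_sq_sum
    (fun d => C i d - ∑ k' ∈ Finset.univ.erase k, U i k' * V k' d) (fun d => V k d)
  have h2 := expand_sq_sum
    (fun m => G i m - ∑ k' ∈ Finset.univ.erase k, U i k' * W m k') (fun m => W m k)
  rw [eq_div_iff hDpos.ne'] at htstar
  have hpos : 0 < D * (t - tstar) ^ 2 :=
    mul_pos hDpos (by have := sub_ne_zero.mpr ht; positivity)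
  have key : φ t - φ tstar = D * (t - tstar) ^ 2 := by
    rw [hφ t, hφ tstar, h1 t, h1 tstar, h2 t, h2 tstar]
    linear_combination (-2 * (tstar - t)) * htstar - (t ^ 2 - tstar ^ 2) * hD
  linarith
end
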